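/- Let N = 6, m ≥ 2, and let (λ̄, u^{m−1}) solve the overdetermined radial problem, with u^{m−1} nondegenerate, and let v₀ be as in the context. Then 1 + 2v₀(0) ≠ 0. Moreover, if m = 2 (so that u^{m−1} has one nodal zone and u^{m−1} < 0 on [0,1)) and in addition the linearized operator has Morse index one (i.e. the quadratic form Q(z) = ∫_B ( |∇z|² − (2|u^{m−1}| + λ̄)z² ) dx is negative on a one-dimensional subspace of radial H¹₀(B) functions but not on any two-dimensional one), then 1 + 2v₀(0) > 0. -/

import Mathlib

open Real Set Filter Topology intervalIntegral


/-- `(lamBar, w)` solves the overdetermined radial problem in dimension `6`: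
`w'' + (5/r)w' + |w|w + lamBar·w = 0` on `(0,1)`, `w'(0) = 0`, `w(1) = 0`,
`w(0) = -lamBar/2`, and `w` has exactly `m - 1` nodal zones (`m - 2` zeros in `(0,1)`). -/
structure OverdetSol (lamBar : ℝ) (m : ℕ) (w w' w'' : ℝ → ℝ) : Prop where
  lam_pos : 0 < lamBar
  deriv_fst : ∀ r ∈ Set.Icc (0:ℝ) 1, HasDerivWithinAt w (w' r) (Set.Icc (0:ℝ) 1) r
  deriv_snd : ∀ r ∈ Set.Icc (0:ℝ) 1, HasDerivWithinAt w' (w'' r) (Set.Icc (0:ℝ) 1) r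
  ode : ∀ r ∈ Set.Ioo (0:ℝ) 1, w'' r + (5 / r) * w' r + |w r| * w r + lamBar * w r = 0
  bc_deriv_zero : w' 0 = 0
  bc_one : w 1 = 0
  val_zero : w 0 = -lamBar / 2
  nodal : {r : ℝ | r ∈ Set.Ioo (0:ℝ) 1 ∧ w r = 0}.ncard = m - 2

/-- Nondegeneracy of a solution `w` of the overdetermined problem: the only radial
solution of the linearized equation with Dirichlet boundary conditions is the trivial one. -/
def Nondeg (lamBar : ℝ) (w : ℝ → ℝ) : Prop :=
  ∀ v v' v'' : ℝ → ℝ,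
    (∀ r ∈ Set.Icc (0:ℝ) 1, HasDerivWithinAt v (v' r) (Set.Icc (0:ℝ) 1) r) →
    (∀ r ∈ Set.Icc (0:ℝ) 1, HasDerivWithinAt v' (v'' r) (Set.Icc (0:ℝ) 1) r) →
    (∀ r ∈ Set.Ioo (0:ℝ) 1, v'' r + (5 / r) * v' r + (2 * |w r| + lamBar) * v r = 0) →
    v' 0 = 0 → v 1 = 0 → ∀ r ∈ Set.Icc (0:ℝ) 1, v r = 0

/-- Admissible radial test function (with a.e. derivative `zd`) for the quadratic form
of the linearized operator: continuous on `[0,1]`, vanishing at `1`, piecewise `C¹`. -/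
def AdmissibleRad (z zd : ℝ → ℝ) : Prop :=
  ContinuousOn z (Set.Icc (0:ℝ) 1) ∧ z 1 = 0 ∧
  (∃ F : Set ℝ, F.Finite ∧
    ∀ r ∈ Set.Icc (0:ℝ) 1 \ F, HasDerivWithinAt z (zd r) (Set.Icc (0:ℝ) 1) r) ∧
  IntervalIntegrable (fun r => r ^ 5 * (zd r) ^ 2) MeasureTheory.volume 0 1

/-- The quadratic form `Q(z) = ∫_B (|∇z|² - (2|u^{m-1}| + λ̄) z²) dx` of the linearized
operator, written in radial coordinates (`π³` is the surface area of `S⁵`). -/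
noncomputable def Qform (lamBar : ℝ) (w : ℝ → ℝ) (z zd : ℝ → ℝ) : ℝ :=
  π ^ 3 * ∫ r in (0:ℝ)..1, r ^ 5 * ((zd r) ^ 2 - (2 * |w r| + lamBar) * (z r) ^ 2)

/-- The linearized operator has Morse index one: the quadratic form is negative on a
one-dimensional subspace of radial `H¹₀(B)` functions but not on any two-dimensional one. -/
def MorseIndexOne (lamBar : ℝ) (w : ℝ → ℝ) : Prop :=
  (∃ z zd : ℝ → ℝ, AdmissibleRad z zd ∧ Qform lamBar w z zd < 0) ∧
  ¬ ∃ z₁ zd₁ z₂ zd₂ : ℝ → ℝ, AdmissibleRad z₁ zd₁ ∧ AdmissibleRad z₂ zd₂ ∧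
      LinearIndependent ℝ ![(Set.Icc (0:ℝ) 1).restrict z₁, (Set.Icc (0:ℝ) 1).restrict z₂] ∧
      ∀ a b : ℝ, (a ≠ 0 ∨ b ≠ 0) →
        Qform lamBar w (fun r => a * z₁ r + b * z₂ r) (fun r => a * zd₁ r + b * zd₂ r) < 0


open MeasureTheory in
/-- essentially bounded measurable on the unit interval -/
def GoodF (f : ℝ → ℝ) : Prop := MemLp f ⊤ (volume.restrict (Set.Ioc (0:ℝ) 1))

open MeasureTheory in
lemma GoodF.of_cont {f : ℝ → ℝ} (hf : ContinuousOn f (Set.Icc 0 1)) : GoodF f := by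
  obtain ⟨C, hC⟩ := isCompact_Icc.exists_bound_of_continuousOn hf
  refine memLp_top_of_bound
    ((hf.mono Ioc_subset_Icc_self).aestronglyMeasurable measurableSet_Ioc) C ?_
  refine (ae_restrict_iff' measurableSet_Ioc).2 (Eventually.of_forall fun x hx => ?_)
  exact hC x (Ioc_subset_Icc_self hx)

open MeasureTheory in
lemma GoodF.mul {f g : ℝ → ℝ} (hf : GoodF f) (hg : GoodF g) : GoodF (fun r => f r * g r) :=
  MemLp.mul (p := ⊤) (q := ⊤) (r := ⊤) hg hf

lemma GoodF.add {f g : ℝ → ℝ} (hf : GoodF f) (hg : GoodF g) : GoodF (fun r => f r + g r) :=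
  MeasureTheory.MemLp.add hf hg

lemma GoodF.sub {f g : ℝ → ℝ} (hf : GoodF f) (hg : GoodF g) : GoodF (fun r => f r - g r) :=
  MeasureTheory.MemLp.sub hf hg

lemma GoodF.cmul {f : ℝ → ℝ} (c : ℝ) (hf : GoodF f) : GoodF (fun r => c * f r) :=
  MeasureTheory.MemLp.const_mul hf c

lemma GoodF.ind {f : ℝ → ℝ} (c : ℝ) (hf : GoodF f) : GoodF ((Set.Iic c).indicator f) :=
  MeasureTheory.MemLp.indicator measurableSet_Iic hf

lemma GoodF.ii {f : ℝ → ℝ} (hf : GoodF f) :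
    IntervalIntegrable f MeasureTheory.volume 0 1 := by
  rw [intervalIntegrable_iff_integrableOn_Ioc_of_le zero_le_one]
  exact MeasureTheory.MemLp.integrable le_top hf

lemma goodF_pow : GoodF (fun r => r ^ 5) := GoodF.of_cont (by fun_prop)

/-- the bilinear form -/
noncomputable def Bf (V z zd y yd : ℝ → ℝ) : ℝ :=
  ∫ r in (0:ℝ)..1, r ^ 5 * (zd r * yd r - V r * (z r * y r))

lemma Bf_symm (V z zd y yd : ℝ → ℝ) : Bf V z zd y yd = Bf V y yd z zd := by
  unfold Bf; congr 1; ext r; ring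

lemma Bf_good {V z zd y yd : ℝ → ℝ} (hV : GoodF V) (hz : GoodF z) (hzd : GoodF zd)
    (hy : GoodF y) (hyd : GoodF yd) :
    GoodF (fun r => r ^ 5 * (zd r * yd r - V r * (z r * y r))) :=
  goodF_pow.mul ((hzd.mul hyd).sub (hV.mul (hz.mul hy)))

lemma Bf_lin {V f fd g gd y yd : ℝ → ℝ} (hV : GoodF V) (hf : GoodF f) (hfd : GoodF fd)
    (hg : GoodF g) (hgd : GoodF gd) (hy : GoodF y) (hyd : GoodF yd) (a b : ℝ) :
    Bf V (fun r => a * f r + b * g r) (fun r => a * fd r + b * gd r) y yd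
      = a * Bf V f fd y yd + b * Bf V g gd y yd := by
  have h1 := (Bf_good hV hf hfd hy hyd).cmul a
  have h2 := (Bf_good hV hg hgd hy hyd).cmul b
  unfold Bf
  rw [← intervalIntegral.integral_const_mul, ← intervalIntegral.integral_const_mul,
    ← intervalIntegral.integral_add h1.ii h2.ii]
  congr 1; ext r; ring

/-- integration by parts on `[0,a]` -/
lemma Bf_ind {V f fd fdd y yd : ℝ → ℝ} {a : ℝ} (ha0 : 0 < a) (ha1 : a ≤ 1)
    (hVc : ContinuousOn V (Set.Icc 0 1))
    (hfc : ContinuousOn f (Set.Icc 0 1)) (hfdc : ContinuousOn fd (Set.Icc 0 1))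
    (hyc : ContinuousOn y (Set.Icc 0 1)) (hydc : ContinuousOn yd (Set.Icc 0 1))
    (h2 : ∀ r ∈ Set.Ioo (0:ℝ) 1, HasDerivAt fd (fdd r) r)
    (hy : ∀ r ∈ Set.Ioo (0:ℝ) 1, HasDerivAt y (yd r) r)
    (ode : ∀ r ∈ Set.Ioo (0:ℝ) 1, fdd r + (5 / r) * fd r + V r * f r = 0) :
    ∫ r in (0:ℝ)..a, r ^ 5 * (fd r * yd r - V r * (f r * y r)) = a ^ 5 * fd a * y a := by
  have hsub : Set.Icc 0 a ⊆ Set.Icc (0:ℝ) 1 := Icc_subset_Icc_right ha1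
  have hc : ContinuousOn (fun r => r ^ 5 * (fd r * yd r - V r * (f r * y r))) (Set.Icc 0 1) := by
    fun_prop
  have := intervalIntegral.integral_eq_sub_of_hasDerivAt_of_le (a := 0) (b := a)
    (f := fun r => r ^ 5 * fd r * y r)
    (f' := fun r => r ^ 5 * (fd r * yd r - V r * (f r * y r))) ha0.le
    (by
      have : ContinuousOn (fun r => r ^ 5 * fd r * y r) (Set.Icc 0 1) := by fun_prop
      exact this.mono hsub)
    (by
      intro r hr
      have hr' : r ∈ Set.Ioo (0:ℝ) 1 := ⟨hr.1, hr.2.trans_le ha1⟩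
      have hr0 : r ≠ 0 := hr.1.ne'
      have := ((hasDerivAt_pow 5 r).mul (h2 r hr')).mul (hy r hr')
      refine this.congr_deriv ?_
      have e : fdd r = - (5 / r) * fd r - V r * f r := by linarith [ode r hr']
      simp only [Pi.mul_apply]
      rw [e]
      field_simp
      push_cast
      ring)
    (by
      apply ContinuousOn.intervalIntegrable
      rw [uIcc_of_le ha0.le]
      exact hc.mono hsub)
  rw [this]; simp

lemma int_ind {F G : ℝ → ℝ} {a : ℝ} (ha0 : 0 < a) (ha1 : a ≤ 1) (hF : F = (Set.Iic a).indicator G) :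
    ∫ r in (0:ℝ)..1, F r = ∫ r in (0:ℝ)..a, G r := by
  rw [hF]
  exact intervalIntegral.integral_indicator ⟨ha0.le, ha1⟩

/-- uniqueness for the radial ODE -/
lemma uniq {f fd fdd P : ℝ → ℝ} {M : ℝ} (hP : ∀ r ∈ Set.Icc (0:ℝ) 1, |P r| ≤ M)
    (hfc : ContinuousOn f (Set.Icc 0 1)) (hfdc : ContinuousOn fd (Set.Icc 0 1))
    (h1 : ∀ r ∈ Set.Ioo (0:ℝ) 1, HasDerivAt f (fd r) r)
    (h2 : ∀ r ∈ Set.Ioo (0:ℝ) 1, HasDerivAt fd (fdd r) r)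
    (ode : ∀ r ∈ Set.Ioo (0:ℝ) 1, fdd r + (5 / r) * fd r + P r * f r = 0)
    {c : ℝ} (hc : c ∈ Set.Icc (0:ℝ) 1) (hf0 : f c = 0) (hfd0 : fd c = 0) :
    ∀ r ∈ Set.Icc (0:ℝ) 1, f r = 0 := by
  have key : ∀ r ∈ Set.Ioo (0:ℝ) 1, |2 * (fd r * ((1 - P r) * f r))| ≤ (1 + M) * (fd r ^ 2 + f r ^ 2) := by
    intro r hr
    have hp := hP r (Ioo_subset_Icc_self hr)
    have hq : |1 - P r| ≤ 1 + M := by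
      rw [abs_le] at hp ⊢; constructor <;> linarith
    have e : |2 * (fd r * ((1 - P r) * f r))| = |1 - P r| * (2 * |fd r| * |f r|) := by
      simp only [abs_mul, abs_two]; ring
    rw [e]
    have : 2 * |fd r| * |f r| ≤ fd r ^ 2 + f r ^ 2 := by
      have := two_mul_le_add_sq |fd r| |f r|
      simpa using this
    exact mul_le_mul hq this (by positivity) ((abs_nonneg _).trans hq)
  -- backward
  have back : ∀ r ∈ Set.Icc (0:ℝ) 1, r ≤ c → 0 < r → f r = 0 := by
    intro r hr hrc hr0
    have mono : MonotoneOn (fun r => r ^ 10 * (Real.exp ((1 + M) * r) * (fd r ^ 2 + f r ^ 2))) (Set.Icc 0 1) := by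
      refine monotoneOn_of_hasDerivWithinAt_nonneg (convex_Icc _ _) (by fun_prop)
        (f' := fun r => 10 * r ^ 9 * (Real.exp ((1 + M) * r) * (fd r ^ 2 + f r ^ 2)) +
          r ^ 10 * (Real.exp ((1 + M) * r) * (1 + M) * (fd r ^ 2 + f r ^ 2) +
            Real.exp ((1 + M) * r) * (2 * fd r * fdd r + 2 * f r * fd r))) ?_ ?_
      · intro x hx
        rw [interior_Icc] at hx
        have hh := (hasDerivAt_pow 10 x).mul ((((hasDerivAt_id x).const_mul (1 + M)).exp).mul
          (((h2 x hx).pow 2).add ((h1 x hx).pow 2)))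
        refine HasDerivAt.hasDerivWithinAt ?_
        refine hh.congr_deriv ?_
        simp
      · intro x hx
        rw [interior_Icc] at hx
        have hx0 := hx.1
        have e : fdd x = - (5 / x) * fd x - P x * f x := by linarith [ode x hx]
        have k := (abs_le.1 (key x hx)).1
        have : 10 * x ^ 9 * (Real.exp ((1 + M) * x) * (fd x ^ 2 + f x ^ 2)) +
          x ^ 10 * (Real.exp ((1 + M) * x) * (1 + M) * (fd x ^ 2 + f x ^ 2) +
            Real.exp ((1 + M) * x) * (2 * fd x * fdd x + 2 * f x * fd x)) =
          Real.exp ((1 + M) * x) * (10 * x ^ 9 * f x ^ 2 + x ^ 10 * ((1 + M) * (fd x ^ 2 + f x ^ 2) +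
            2 * (fd x * ((1 - P x) * f x)))) := by
          rw [e]; field_simp; ring
        rw [this]
        have : 0 ≤ (1 + M) * (fd x ^ 2 + f x ^ 2) + 2 * (fd x * ((1 - P x) * f x)) := by linarith
        positivity
    have hm := mono hr hc hrc
    simp only [hf0, hfd0] at hm
    have hpos : 0 < r ^ 10 * Real.exp ((1 + M) * r) := by positivity
    have : fd r ^ 2 + f r ^ 2 ≤ 0 := by
      by_contra! h
      have := mul_pos hpos h
      norm_num at hm
      linarith
    have : f r ^ 2 = 0 := by nlinarith [sq_nonneg (fd r), sq_nonneg (f r)]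
    simpa using this
  have fwd : ∀ r ∈ Set.Icc (0:ℝ) 1, c ≤ r → f r = 0 := by
    intro r hr hrc
    have mono : AntitoneOn (fun r => Real.exp (-(1 + M) * r) * (fd r ^ 2 + f r ^ 2)) (Set.Icc 0 1) := by
      refine antitoneOn_of_hasDerivWithinAt_nonpos (convex_Icc _ _) (by fun_prop)
        (f' := fun r => (Real.exp (-(1 + M) * r) * (-(1 + M)) * (fd r ^ 2 + f r ^ 2) +
            Real.exp (-(1 + M) * r) * (2 * fd r * fdd r + 2 * f r * fd r))) ?_ ?_
      · intro x hx
        rw [interior_Icc] at hx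
        have hh := ((((hasDerivAt_id x).const_mul (-(1 + M))).exp).mul
          (((h2 x hx).pow 2).add ((h1 x hx).pow 2)))
        refine HasDerivAt.hasDerivWithinAt ?_
        refine hh.congr_deriv ?_
        simp
      · intro x hx
        rw [interior_Icc] at hx
        have hx0 := hx.1
        have e : fdd x = - (5 / x) * fd x - P x * f x := by linarith [ode x hx]
        have k := (abs_le.1 (key x hx)).2
        have : Real.exp (-(1 + M) * x) * (-(1 + M)) * (fd x ^ 2 + f x ^ 2) +
            Real.exp (-(1 + M) * x) * (2 * fd x * fdd x + 2 * f x * fd x) =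
          -(Real.exp (-(1 + M) * x) * (10 / x * fd x ^ 2 + ((1 + M) * (fd x ^ 2 + f x ^ 2) -
            2 * (fd x * ((1 - P x) * f x))))) := by
          rw [e]; field_simp; ring
        rw [this]
        have : 0 ≤ (1 + M) * (fd x ^ 2 + f x ^ 2) - 2 * (fd x * ((1 - P x) * f x)) := by linarith
        have : 0 ≤ Real.exp (-(1 + M) * x) * (10 / x * fd x ^ 2 + ((1 + M) * (fd x ^ 2 + f x ^ 2) -
            2 * (fd x * ((1 - P x) * f x)))) := by positivity
        linarith
    have hm := mono hc hr hrc
    simp only [hf0, hfd0] at hm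
    have hpos : 0 < Real.exp (-(1 + M) * r) := by positivity
    have : fd r ^ 2 + f r ^ 2 ≤ 0 := by
      by_contra! h
      have := mul_pos hpos h
      norm_num at hm this
      linarith
    have : f r ^ 2 = 0 := by nlinarith [sq_nonneg (fd r), sq_nonneg (f r)]
    simpa using this
  intro r hr
  rcases le_or_gt c r with h | h
  · exact fwd r hr h
  · rcases hr.1.eq_or_lt with h0 | h0
    · -- r = 0 < c : continuity
      subst h0
      have hT : Tendsto f (𝓝[>] 0) (𝓝 (f 0)) := by
        have := (hfc 0 hr)
        refine this.mono_left ?_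
        rw [← nhdsWithin_Ioc_eq_nhdsGT (zero_lt_one' ℝ)]
        exact nhdsWithin_mono _ Ioc_subset_Icc_self
      have hT2 : Tendsto f (𝓝[>] 0) (𝓝 0) := by
        refine tendsto_const_nhds.congr' ?_
        filter_upwards [Ioc_mem_nhdsGT h] with x hx
        exact (back x ⟨hx.1.le, hx.2.trans hc.2⟩ hx.2 hx.1).symm
      exact tendsto_nhds_unique hT hT2
    · exact back r hr h.le h0

lemma hd_abs_mul (x : ℝ) : HasDerivAt (fun x : ℝ => |x| * x) (2 * |x|) x := by
  rcases lt_trichotomy x 0 with h | h | h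
  · have : HasDerivAt (fun x : ℝ => -(x ^ 2)) (2 * |x|) x := by
      refine (hasDerivAt_pow 2 x).neg.congr_deriv ?_
      rw [abs_of_neg h]; push_cast; ring
    refine this.congr_of_eventuallyEq ?_
    filter_upwards [gt_mem_nhds h] with y hy
    rw [abs_of_neg hy]; ring
  · subst h
    rw [hasDerivAt_iff_tendsto_slope]
    have : Tendsto (fun y : ℝ => |y|) (𝓝[≠] 0) (𝓝 (2 * |(0:ℝ)|)) := by
      have : Tendsto (fun y : ℝ => |y|) (𝓝 0) (𝓝 (|(0:ℝ)|)) := continuous_abs.tendsto 0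
      simpa using this.mono_left nhdsWithin_le_nhds
    refine this.congr' ?_
    filter_upwards [self_mem_nhdsWithin] with y hy
    have : y ≠ 0 := hy
    simp [slope, this]
    field_simp
  · have : HasDerivAt (fun x : ℝ => (x ^ 2)) (2 * |x|) x := by
      refine (hasDerivAt_pow 2 x).congr_deriv ?_
      rw [abs_of_pos h]; push_cast; ring
    refine this.congr_of_eventuallyEq ?_
    filter_upwards [lt_mem_nhds h] with y hy
    rw [abs_of_pos hy]; ring

lemma not_morse {lamBar : ℝ} {w wd wdd φ φd φdd : ℝ → ℝ}
    (hwc : ContinuousOn w (Set.Icc 0 1)) (hwdc : ContinuousOn wd (Set.Icc 0 1))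
    (hw1 : ∀ r ∈ Set.Ioo (0:ℝ) 1, HasDerivAt w (wd r) r)
    (hw2 : ∀ r ∈ Set.Ioo (0:ℝ) 1, HasDerivAt wd (wdd r) r)
    (hwode : ∀ r ∈ Set.Ioo (0:ℝ) 1, wdd r + (5 / r) * wd r + (|w r| + lamBar) * w r = 0)
    (hwone : w 1 = 0) (hneg : ∀ r ∈ Set.Ico (0:ℝ) 1, w r < 0)
    (hφc : ContinuousOn φ (Set.Icc 0 1)) (hφdc : ContinuousOn φd (Set.Icc 0 1))
    (hφ1 : ∀ r ∈ Set.Ioo (0:ℝ) 1, HasDerivAt φ (φd r) r)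
    (hφ2 : ∀ r ∈ Set.Ioo (0:ℝ) 1, HasDerivAt φd (φdd r) r)
    (hφode : ∀ r ∈ Set.Ioo (0:ℝ) 1,
      φdd r + (5 / r) * φd r + (2 * |w r| + lamBar) * φ r = 0)
    {a b : ℝ} (ha0 : 0 < a) (hab : a < b) (hb1 : b < 1)
    (hφa : φ a = 0) (hφb : φ b = 0) (hda : φd a ≠ 0) (hdb : φd b ≠ 0) :
    ¬ MorseIndexOne lamBar w := by
  rintro ⟨-, hM⟩
  apply hM
  have hb0 : 0 < b := ha0.trans hab
  have ha1 : a < 1 := hab.trans hb1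
  have hwa : w a < 0 := hneg a ⟨ha0.le, ha1⟩
  have hwb : w b < 0 := hneg b ⟨hb0.le, hb1⟩
  set V : ℝ → ℝ := fun r => 2 * |w r| + lamBar with hVdef
  have hVc : ContinuousOn V (Set.Icc 0 1) := by
    have := hwc.abs
    fun_prop
  have hV := GoodF.of_cont hVc
  have gw := GoodF.of_cont hwc
  have gwd := GoodF.of_cont hwdc
  have gφ := GoodF.of_cont hφc
  have gφd := GoodF.of_cont hφdc
  set η : ℝ → ℝ := fun r => (r - a) * (1 - r) with hη
  set ηd : ℝ → ℝ := fun r => 1 + a - 2 * r with hηd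
  have hηc : ContinuousOn η (Set.Icc 0 1) := by fun_prop
  have hηdc : ContinuousOn ηd (Set.Icc 0 1) := by fun_prop
  have hη1 : ∀ r, HasDerivAt η (ηd r) r := by
    intro r
    refine (((hasDerivAt_id r).sub_const a).mul ((hasDerivAt_id r).const_sub 1)).congr_deriv ?_
    simp [hηd]; ring
  have gη := GoodF.of_cont hηc
  have gηd := GoodF.of_cont hηdc
  set z1 : ℝ → ℝ := (Set.Iic a).indicator φ with hz1
  set z1d : ℝ → ℝ := (Set.Iic a).indicator φd with hz1d
  set z2 : ℝ → ℝ := (Set.Iic b).indicator φ with hz2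
  set z2d : ℝ → ℝ := (Set.Iic b).indicator φd with hz2d
  have g1 : GoodF z1 := gφ.ind a
  have g1d : GoodF z1d := gφd.ind a
  have g2 : GoodF z2 := gφ.ind b
  have g2d : GoodF z2d := gφd.ind b
  -- values of the bilinear form
  have B1 : ∀ y yd : ℝ → ℝ, ContinuousOn y (Set.Icc 0 1) → ContinuousOn yd (Set.Icc 0 1) →
      (∀ r ∈ Set.Ioo (0:ℝ) 1, HasDerivAt y (yd r) r) →
      Bf V z1 z1d y yd = a ^ 5 * φd a * y a := by
    intro y yd hy hyd hyy
    rw [← Bf_ind (V := V) (f := φ) ha0 ha1.le hVc hφc hφdc hy hyd hφ2 hyy hφode]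
    refine int_ind ha0 ha1.le ?_
    ext r
    by_cases h : r ∈ Set.Iic a <;> simp [hz1, hz1d, h]
  have B2 : ∀ y yd : ℝ → ℝ, ContinuousOn y (Set.Icc 0 1) → ContinuousOn yd (Set.Icc 0 1) →
      (∀ r ∈ Set.Ioo (0:ℝ) 1, HasDerivAt y (yd r) r) →
      Bf V z2 z2d y yd = b ^ 5 * φd b * y b := by
    intro y yd hy hyd hyy
    rw [← Bf_ind (V := V) (f := φ) hb0 hb1.le hVc hφc hφdc hy hyd hφ2 hyy hφode]
    refine int_ind hb0 hb1.le ?_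
    ext r
    by_cases h : r ∈ Set.Iic b <;> simp [hz2, hz2d, h]
  have B11 : Bf V z1 z1d z1 z1d = 0 := by
    have : Bf V z1 z1d z1 z1d = Bf V z1 z1d φ φd := by
      unfold Bf; congr 1; ext r
      by_cases h : r ∈ Set.Iic a <;> simp [hz1, hz1d, h]
    rw [this, B1 φ φd hφc hφdc hφ1, hφa, mul_zero]
  have B22 : Bf V z2 z2d z2 z2d = 0 := by
    have : Bf V z2 z2d z2 z2d = Bf V z2 z2d φ φd := by
      unfold Bf; congr 1; ext r
      by_cases h : r ∈ Set.Iic b <;> simp [hz2, hz2d, h]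
    rw [this, B2 φ φd hφc hφdc hφ1, hφb, mul_zero]
  have B12 : Bf V z1 z1d z2 z2d = 0 := by
    have : Bf V z1 z1d z2 z2d = Bf V z1 z1d φ φd := by
      unfold Bf; congr 1; ext r
      by_cases h : r ∈ Set.Iic a
      · have h' : r ∈ Set.Iic b := le_trans h hab.le
        simp [hz1, hz1d, hz2, hz2d, h, h']
      · simp [hz1, hz1d, h]
    rw [this, B1 φ φd hφc hφdc hφ1, hφa, mul_zero]
  have B1w := B1 w wd hwc hwdc hw1
  have B2w := B2 w wd hwc hwdc hw1
  have B1η := B1 η ηd hηc hηdc (fun r _ => hη1 r)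
  have B2η := B2 η ηd hηc hηdc (fun r _ => hη1 r)
  have hηa : η a = 0 := by simp [hη]
  have hηb : 0 < η b := mul_pos (by linarith) (by linarith)
  rw [hηa, mul_zero] at B1η
  have Bww : Bf V w wd w wd < 0 := by
    have hwabs := hwc.abs
    have h1 := Bf_ind (V := fun r => |w r| + lamBar) (f := w) one_pos le_rfl
      (by fun_prop) hwc hwdc hwc hwdc hw2 hw1 hwode
    rw [hwone, mul_zero] at h1
    have hcube : ContinuousOn (fun r => r ^ 5 * (|w r| * (w r * w r))) (Set.Icc 0 1) := by fun_prop
    have h2 : 0 < ∫ r in (0:ℝ)..1, r ^ 5 * (|w r| * (w r * w r)) := by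
      refine intervalIntegral.intervalIntegral_pos_of_pos_on (GoodF.of_cont hcube).ii ?_ one_pos
      intro x hx
      have := hneg x ⟨hx.1.le, hx.2⟩
      have h3 : 0 < |w x| := abs_pos.2 this.ne
      have h4 : 0 < w x * w x := mul_pos_of_neg_of_neg this this
      have h5 := hx.1
      positivity
    have h3 : Bf V w wd w wd = (∫ r in (0:ℝ)..1, r ^ 5 * (wd r * wd r - (|w r| + lamBar) * (w r * w r)))
        - ∫ r in (0:ℝ)..1, r ^ 5 * (|w r| * (w r * w r)) := by
      rw [← intervalIntegral.integral_sub (GoodF.of_cont (by fun_prop)).ii (GoodF.of_cont hcube).ii]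
      unfold Bf; congr 1; ext r; simp only [hVdef]; ring
    rw [h3, h1]; linarith
  set p := a ^ 5 * φd a with hp
  set q := b ^ 5 * φd b with hq
  have hp0 : p ≠ 0 := mul_ne_zero (by positivity) hda
  have hq0 : q ≠ 0 := mul_ne_zero (by positivity) hdb
  set ψ : ℝ → ℝ := fun r => (q * w b) * z1 r + (-(p * w a)) * z2 r with hψ
  set ψd : ℝ → ℝ := fun r => (q * w b) * z1d r + (-(p * w a)) * z2d r with hψd
  have gψ : GoodF ψ := (g1.cmul _).add (g2.cmul _)
  have gψd : GoodF ψd := (g1d.cmul _).add (g2d.cmul _)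
  have Bψw : Bf V ψ ψd w wd = 0 := by
    rw [hψ, hψd, Bf_lin hV g1 g1d g2 g2d gw gwd, B1w, B2w]; ring
  have Bψη : Bf V ψ ψd η ηd = -(p * q * w a * η b) := by
    rw [hψ, hψd, Bf_lin hV g1 g1d g2 g2d gη gηd, B1η, B2η]; ring
  have Bψψ : Bf V ψ ψd ψ ψd = 0 := by
    have e1 : Bf V z1 z1d ψ ψd = 0 := by
      rw [Bf_symm, hψ, hψd, Bf_lin hV g1 g1d g2 g2d g1 g1d, B11, Bf_symm V z2, B12]; ring
    have e2 : Bf V z2 z2d ψ ψd = 0 := by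
      rw [Bf_symm, hψ, hψd, Bf_lin hV g1 g1d g2 g2d g2 g2d, B12, B22]; ring
    have := Bf_lin hV g1 g1d g2 g2d gψ gψd (q * w b) (-(p * w a))
    rw [e1, e2] at this
    rw [← hψ, ← hψd] at this
    rw [this]; ring
  set S := Bf V ψ ψd η ηd with hS
  have hS0 : S ≠ 0 := by
    rw [Bψη]
    exact neg_ne_zero.2 (mul_ne_zero (mul_ne_zero (mul_ne_zero hp0 hq0) hwa.ne) hηb.ne')
  -- choose the perturbation parameter
  set R := Bf V w wd η ηd with hR
  set T := Bf V η ηd η ηd with hT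
  set K := -Bf V w wd w wd with hK
  have hK0 : 0 < K := by rw [hK]; linarith
  obtain ⟨e, he0, heq⟩ : ∃ e : ℝ, e ≠ 0 ∧ e ^ 2 * R ^ 2 / K + (2 * e * S + e ^ 2 * T) < 0 := by
    have hD : 0 < R ^ 2 / K + |T| + 1 := by positivity
    refine ⟨-S / (R ^ 2 / K + |T| + 1), div_ne_zero (neg_ne_zero.2 hS0) hD.ne', ?_⟩
    set D := R ^ 2 / K + |T| + 1 with hDd
    have hSS : 0 < S ^ 2 := by positivity
    have e1 : (-S / D) ^ 2 * R ^ 2 / K + (2 * (-S / D) * S + (-S / D) ^ 2 * T) =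
        S ^ 2 / D ^ 2 * (R ^ 2 / K + T - 2 * D) := by
      field_simp; ring
    rw [e1]
    have : R ^ 2 / K + T - 2 * D < 0 := by
      have := le_abs_self T
      have h0 : 0 ≤ R ^ 2 / K := by positivity
      have h1 := abs_nonneg T
      rw [hDd]; linarith
    exact mul_neg_of_pos_of_neg (by positivity) this
  set g : ℝ → ℝ := fun r => 1 * ψ r + e * η r with hg
  set gd : ℝ → ℝ := fun r => 1 * ψd r + e * ηd r with hgd
  have gg : GoodF g := (gψ.cmul _).add (gη.cmul _)
  have ggd : GoodF gd := (gψd.cmul _).add (gηd.cmul _)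
  have Bgw : Bf V g gd w wd = e * R := by
    rw [hg, hgd, Bf_lin hV gψ gψd gη gηd gw gwd, Bψw, Bf_symm V η]; ring
  have Bgg : Bf V g gd g gd = 2 * e * S + e ^ 2 * T := by
    have e1 : Bf V ψ ψd g gd = e * S := by
      rw [Bf_symm, hg, hgd, Bf_lin hV gψ gψd gη gηd gψ gψd, Bψψ, Bf_symm V η]; ring
    have e2 : Bf V η ηd g gd = S + e * T := by
      rw [Bf_symm, hg, hgd, Bf_lin hV gψ gψd gη gηd gη gηd]; ring
    have := Bf_lin hV gψ gψd gη gηd gg ggd 1 e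
    rw [e1, e2] at this
    rw [← hg, ← hgd] at this
    rw [this]; ring
  -- continuity and derivatives of the cut-offs
  have cutc : ∀ c : ℝ, φ c = 0 → ContinuousOn ((Set.Iic c).indicator φ) (Set.Icc 0 1) := by
    intro c hc
    have : (Set.Iic c).indicator φ = fun r => if r ≤ c then φ r else 0 := by
      ext r; simp [Set.indicator_apply]
    rw [this]
    refine ContinuousOn.if ?_ (hφc.mono inter_subset_left) continuousOn_const
    intro x hx
    have h2 : {x | x ≤ c} = Set.Iic c := rfl
    rw [h2, frontier_Iic] at hx
    rw [show x = c from hx.2, hc]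
  have cutd : ∀ c r : ℝ, r ∈ Set.Ioo (0:ℝ) 1 → r ≠ c →
      HasDerivAt ((Set.Iic c).indicator φ) ((Set.Iic c).indicator φd r) r := by
    intro c r hr hrc
    rcases lt_or_gt_of_ne hrc with h | h
    · rw [Set.indicator_of_mem (show r ∈ Set.Iic c from h.le)]
      refine (hφ1 r hr).congr_of_eventuallyEq ?_
      filter_upwards [gt_mem_nhds h] with y hy
      rw [Set.indicator_of_mem (show y ∈ Set.Iic c from le_of_lt hy)]
    · rw [Set.indicator_of_notMem (show r ∉ Set.Iic c from not_le.2 h)]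
      refine (hasDerivAt_const r (0:ℝ)).congr_of_eventuallyEq ?_
      filter_upwards [lt_mem_nhds h] with y hy
      rw [Set.indicator_of_notMem (show y ∉ Set.Iic c from not_le.2 hy)]
  have gsq : ∀ f : ℝ → ℝ, GoodF f →
      IntervalIntegrable (fun r => r ^ 5 * (f r) ^ 2) MeasureTheory.volume 0 1 := by
    intro f hf
    have := (goodF_pow.mul (hf.mul hf)).ii
    simpa only [pow_two] using this
  have z1c := cutc a hφa
  have z2c := cutc b hφb
  have ga : g a = 0 := by
    simp [hg, hψ, hz1, hz2, hφa, hηa, hab.le]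
  have gb : g b = e * η b := by
    simp [hg, hψ, hz1, hz2, hφb, hab]
  refine ⟨w, wd, g, gd, ⟨hwc, hwone, ⟨{0, 1}, by simp, ?_⟩, gsq _ gwd⟩,
    ⟨?_, ?_, ⟨{0, 1, a, b}, by simp, ?_⟩, gsq _ ggd⟩, ?_, ?_⟩
  · rintro r ⟨hr, hr'⟩
    simp only [Set.mem_insert_iff, Set.mem_singleton_iff, not_or] at hr'
    exact (hw1 r ⟨lt_of_le_of_ne hr.1 (Ne.symm hr'.1),
      lt_of_le_of_ne hr.2 hr'.2⟩).hasDerivWithinAt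
  · have : ContinuousOn ψ (Set.Icc 0 1) :=
      (continuousOn_const.mul z1c).add (continuousOn_const.mul z2c)
    exact (continuousOn_const.mul this).add (continuousOn_const.mul hηc)
  · simp [hg, hψ, hz1, hz2, hη, ha1, hb1]
  · rintro r ⟨hr, hr'⟩
    simp only [Set.mem_insert_iff, Set.mem_singleton_iff, not_or] at hr'
    have hrI : r ∈ Set.Ioo (0:ℝ) 1 := ⟨lt_of_le_of_ne hr.1 (Ne.symm hr'.1),
      lt_of_le_of_ne hr.2 hr'.2.1⟩
    have d1 := cutd a r hrI hr'.2.2.1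
    have d2 := cutd b r hrI hr'.2.2.2
    exact ((((d1.const_mul (q * w b)).add (d2.const_mul (-(p * w a)))).const_mul 1).add
      ((hη1 r).const_mul e)).hasDerivWithinAt
  · rw [LinearIndependent.pair_iff]
    intro x y hxy
    have ea : x * w a + y * g a = 0 := congrFun hxy ⟨a, ha0.le, ha1.le⟩
    have eb : x * w b + y * g b = 0 := congrFun hxy ⟨b, hb0.le, hb1.le⟩
    rw [ga, mul_zero, add_zero] at ea
    have hx : x = 0 := (mul_eq_zero.1 ea).resolve_right hwa.ne
    rw [hx, gb, zero_mul, zero_add] at eb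
    exact ⟨hx, (mul_eq_zero.1 eb).resolve_right (mul_ne_zero he0 hηb.ne')⟩
  · intro x y hxy
    have hQ : Qform lamBar w (fun r => x * w r + y * g r) (fun r => x * wd r + y * gd r)
        = π ^ 3 * Bf V (fun r => x * w r + y * g r) (fun r => x * wd r + y * gd r)
          (fun r => x * w r + y * g r) (fun r => x * wd r + y * gd r) := by
      unfold Qform Bf; congr 2; ext r; simp only [hVdef]; ring
    have e1 : Bf V (fun r => x * w r + y * g r) (fun r => x * wd r + y * gd r)
          (fun r => x * w r + y * g r) (fun r => x * wd r + y * gd r)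
        = x ^ 2 * (-K) + 2 * x * y * (e * R) + y ^ 2 * (2 * e * S + e ^ 2 * T) := by
      rw [Bf_lin hV gw gwd gg ggd ((gw.cmul x).add (gg.cmul y)) ((gwd.cmul x).add (ggd.cmul y)),
        Bf_symm V w, Bf_symm V g, Bf_lin hV gw gwd gg ggd gw gwd, Bf_lin hV gw gwd gg ggd gg ggd,
        Bgg, Bgw, Bf_symm V w wd g, Bgw, hK]
      ring
    rw [hQ, e1]
    refine mul_neg_of_pos_of_neg (by positivity) ?_
    have e2 : x ^ 2 * (-K) + 2 * x * y * (e * R) + y ^ 2 * (2 * e * S + e ^ 2 * T)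
        = -(K * (x - y * e * R / K) ^ 2) +
          y ^ 2 * (e ^ 2 * R ^ 2 / K + (2 * e * S + e ^ 2 * T)) := by
      field_simp; ring
    rw [e2]
    by_cases hy : y = 0
    · have hx : x ≠ 0 := by
        rcases hxy with h | h
        · exact h
        · exact absurd hy h
      subst hy
      have : 0 < K * x ^ 2 := by positivity
      simpa using this
    · have h1 : 0 ≤ K * (x - y * e * R / K) ^ 2 := by positivity
      have h2 : y ^ 2 * (e ^ 2 * R ^ 2 / K + (2 * e * S + e ^ 2 * T)) < 0 :=
        mul_neg_of_pos_of_neg (by positivity) heq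
      linarith

theorem statement17 (m : ℕ) (hm : 2 ≤ m)
    (lamBar : ℝ) (w w' w'' : ℝ → ℝ) (hw : OverdetSol lamBar m w w' w'')
    (hnd : Nondeg lamBar w)
    (v₀ v₀' v₀'' : ℝ → ℝ)
    (hv₀d1 : ∀ r ∈ Set.Icc (0:ℝ) 1, HasDerivWithinAt v₀ (v₀' r) (Set.Icc (0:ℝ) 1) r)
    (hv₀d2 : ∀ r ∈ Set.Icc (0:ℝ) 1, HasDerivWithinAt v₀' (v₀'' r) (Set.Icc (0:ℝ) 1) r)
    (hv₀ode : ∀ r ∈ Set.Ioo (0:ℝ) 1,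
      v₀'' r + (5 / r) * v₀' r + (2 * |w r| + lamBar) * v₀ r + w r = 0)
    (hv₀bc0 : v₀' 0 = 0) (hv₀bc1 : v₀ 1 = 0) :
    1 + 2 * v₀ 0 ≠ 0 ∧
    (m = 2 → (∀ r ∈ Set.Ico (0:ℝ) 1, w r < 0) → MorseIndexOne lamBar w →
      0 < 1 + 2 * v₀ 0) := by
  obtain ⟨hl, hwd1, hwd2, hwode, hw0', hw1, hw0, -⟩ := hw
  have hwc : ContinuousOn w (Set.Icc 0 1) := fun r hr => (hwd1 r hr).continuousWithinAt
  have hwdc : ContinuousOn w' (Set.Icc 0 1) := fun r hr => (hwd2 r hr).continuousWithinAt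
  have hvc : ContinuousOn v₀ (Set.Icc 0 1) := fun r hr => (hv₀d1 r hr).continuousWithinAt
  have hvdc : ContinuousOn v₀' (Set.Icc 0 1) := fun r hr => (hv₀d2 r hr).continuousWithinAt
  have hI : ∀ r ∈ Set.Ioo (0:ℝ) 1, r ∈ Set.Icc (0:ℝ) 1 ∧ Set.Icc (0:ℝ) 1 ∈ 𝓝 r :=
    fun r hr => ⟨Ioo_subset_Icc_self hr, Icc_mem_nhds hr.1 hr.2⟩
  have hwa : ∀ r ∈ Set.Ioo (0:ℝ) 1, HasDerivAt w (w' r) r :=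
    fun r hr => (hwd1 r (hI r hr).1).hasDerivAt (hI r hr).2
  have hwb : ∀ r ∈ Set.Ioo (0:ℝ) 1, HasDerivAt w' (w'' r) r :=
    fun r hr => (hwd2 r (hI r hr).1).hasDerivAt (hI r hr).2
  have hva : ∀ r ∈ Set.Ioo (0:ℝ) 1, HasDerivAt v₀ (v₀' r) r :=
    fun r hr => (hv₀d1 r (hI r hr).1).hasDerivAt (hI r hr).2
  have hvb : ∀ r ∈ Set.Ioo (0:ℝ) 1, HasDerivAt v₀' (v₀'' r) r :=
    fun r hr => (hv₀d2 r (hI r hr).1).hasDerivAt (hI r hr).2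
  have hwode' : ∀ r ∈ Set.Ioo (0:ℝ) 1, w'' r + (5 / r) * w' r + (|w r| + lamBar) * w r = 0 :=
    fun r hr => by linarith [hwode r hr]
  have hwabs := hwc.abs
  obtain ⟨M1, hM1⟩ := isCompact_Icc.exists_bound_of_continuousOn
    (show ContinuousOn (fun r => |w r| + lamBar) (Set.Icc 0 1) by fun_prop)
  obtain ⟨M2, hM2⟩ := isCompact_Icc.exists_bound_of_continuousOn
    (show ContinuousOn (fun r => 2 * |w r| + lamBar) (Set.Icc 0 1) by fun_prop)
  have h01 : (0:ℝ) ∈ Set.Icc (0:ℝ) 1 := by simp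
  have h11 : (1:ℝ) ∈ Set.Icc (0:ℝ) 1 := by simp
  -- Hopf-type fact at the boundary
  have hw'1 : w' 1 ≠ 0 := by
    intro h
    have := uniq hM1 hwc hwdc hwa hwb hwode' h11 hw1 h 0 h01
    rw [hw0] at this
    linarith
  -- the homogeneous solution
  set φ : ℝ → ℝ := fun r => v₀ r - (2 * w r + r * w' r) / (2 * lamBar) with hφ
  set φd : ℝ → ℝ := fun r => v₀' r + (2 * w' r + r * (|w r| * w r + lamBar * w r)) / (2 * lamBar)
    with hφd
  set φdd : ℝ → ℝ := fun r => v₀'' r + (2 * w'' r + (|w r| * w r + lamBar * w r)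
    + r * (2 * |w r| * w' r + lamBar * w' r)) / (2 * lamBar) with hφdd
  have hφc : ContinuousOn φ (Set.Icc 0 1) := by fun_prop
  have hφdc : ContinuousOn φd (Set.Icc 0 1) := by fun_prop
  have hφ1 : ∀ r ∈ Set.Ioo (0:ℝ) 1, HasDerivAt φ (φd r) r := by
    intro r hr
    have hr0 : r ≠ 0 := hr.1.ne'
    refine ((hva r hr).sub ((((hwa r hr).const_mul 2).add
      ((hasDerivAt_id r).mul (hwb r hr))).div_const (2 * lamBar))).congr_deriv ?_
    have e : w'' r = - (5 / r) * w' r - (|w r| * w r + lamBar * w r) := by linarith [hwode r hr]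
    simp only [hφd, id_eq]
    rw [e]
    field_simp
    ring
  have hφ2 : ∀ r ∈ Set.Ioo (0:ℝ) 1, HasDerivAt φd (φdd r) r := by
    intro r hr
    have hf : HasDerivAt (fun r => |w r| * w r) (2 * |w r| * w' r) r :=
      (hd_abs_mul (w r)).comp r (hwa r hr)
    refine ((hvb r hr).add ((((hwb r hr).const_mul 2).add
      ((hasDerivAt_id r).mul (hf.add ((hwa r hr).const_mul lamBar)))).div_const
        (2 * lamBar))).congr_deriv ?_
    simp [hφdd]
    ring
  have hφode : ∀ r ∈ Set.Ioo (0:ℝ) 1,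
      φdd r + (5 / r) * φd r + (2 * |w r| + lamBar) * φ r = 0 := by
    intro r hr
    have hr0 : r ≠ 0 := hr.1.ne'
    have e : w'' r = - (5 / r) * w' r - (|w r| * w r + lamBar * w r) := by linarith [hwode r hr]
    have e2 : v₀'' r = - (5 / r) * v₀' r - (2 * |w r| + lamBar) * v₀ r - w r := by
      linarith [hv₀ode r hr]
    simp only [hφ, hφd, hφdd]
    rw [e, e2]
    field_simp
    ring
  have hφ0 : φ 0 = v₀ 0 + 1 / 2 := by
    simp only [hφ, hw0]; field_simp; ring
  have hφd0 : φd 0 = 0 := by simp [hφd, hv₀bc0, hw0']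
  have hφone : φ 1 = -(w' 1) / (2 * lamBar) := by
    simp only [hφ, hv₀bc1, hw1]; ring
  have hφ1ne : φ 1 ≠ 0 := by
    rw [hφone]; exact div_ne_zero (neg_ne_zero.2 hw'1) (by positivity)
  have hne : 1 + 2 * v₀ 0 ≠ 0 := by
    intro h
    exact hφ1ne (uniq hM2 hφc hφdc hφ1 hφ2 hφode h01 (by rw [hφ0]; linarith) hφd0 1 h11)
  refine ⟨hne, fun _ hneg hMorse => ?_⟩
  by_contra hcon
  have hφ0neg : φ 0 < 0 := by
    have : 1 + 2 * v₀ 0 < 0 := lt_of_le_of_ne (not_lt.1 hcon) hne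
    rw [hφ0]; linarith
  have hw'1pos : 0 < w' 1 := by
    refine lt_of_le_of_ne ?_ (Ne.symm hw'1)
    have hs := hasDerivWithinAt_iff_tendsto_slope.1 (hwd1 1 h11)
    have hset : Set.Icc (0:ℝ) 1 \ {1} = Set.Ico 0 1 := by
      ext x; simp only [Set.mem_diff, Set.mem_Icc, Set.mem_singleton_iff, Set.mem_Ico]
      constructor
      · rintro ⟨⟨h1, h2⟩, h3⟩; exact ⟨h1, lt_of_le_of_ne h2 h3⟩
      · rintro ⟨h1, h2⟩; exact ⟨⟨h1, h2.le⟩, h2.ne⟩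
    rw [hset, nhdsWithin_Ico_eq_nhdsLT (zero_lt_one' ℝ)] at hs
    refine ge_of_tendsto hs ?_
    filter_upwards [Ico_mem_nhdsLT (zero_lt_one' ℝ)] with x hx
    rw [slope_def_field, hw1]
    exact div_nonneg_of_nonpos (by linarith [hneg x hx]) (by linarith [hx.2])
  have hφ1neg : φ 1 < 0 := by
    rw [hφone]; exact div_neg_of_neg_of_pos (by linarith) (by positivity)
  obtain ⟨c, hc, hcpos⟩ : ∃ c ∈ Set.Icc (0:ℝ) 1, 0 < φ c := by
    by_contra! hle
    have mono : MonotoneOn (fun r => r ^ 5 * (w' r * φ r - w r * φd r)) (Set.Icc 0 1) := by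
      refine monotoneOn_of_hasDerivWithinAt_nonneg (convex_Icc _ _) (by fun_prop)
        (f' := fun r => r ^ 5 * (|w r| * (w r * φ r))) ?_ ?_
      · intro x hx
        rw [interior_Icc] at hx
        have hx0 : x ≠ 0 := hx.1.ne'
        refine (((hasDerivAt_pow 5 x).mul (((hwb x hx).mul (hφ1 x hx)).sub
          ((hwa x hx).mul (hφ2 x hx)))).congr_deriv ?_).hasDerivWithinAt
        have e : w'' x = - (5 / x) * w' x - (|w x| * w x + lamBar * w x) := by
          linarith [hwode x hx]
        have e2 : φdd x = - (5 / x) * φd x - (2 * |w x| + lamBar) * φ x := by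
          linarith [hφode x hx]
        simp only [Pi.mul_apply, Pi.sub_apply]
        rw [e, e2]
        field_simp
        push_cast
        ring
      · intro x hx
        rw [interior_Icc] at hx
        have h1 := hneg x ⟨hx.1.le, hx.2⟩
        have h2 := hle x (Ioo_subset_Icc_self hx)
        have h3 : 0 ≤ w x * φ x := mul_nonneg_of_nonpos_of_nonpos h1.le h2
        have h4 := hx.1
        positivity
    have := mono h01 h11 zero_le_one
    simp only [hw1] at this
    norm_num at this
    have h5 : w' 1 * φ 1 < 0 := mul_neg_of_pos_of_neg hw'1pos hφ1neg
    linarith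
  obtain ⟨a, ha, hφa⟩ := intermediate_value_Ioo hc.1
    (hφc.mono (Icc_subset_Icc_right hc.2)) (show (0:ℝ) ∈ Set.Ioo (φ 0) (φ c) from ⟨hφ0neg, hcpos⟩)
  obtain ⟨b, hb, hφb⟩ := intermediate_value_Ioo' hc.2
    (hφc.mono (Icc_subset_Icc_left hc.1)) (show (0:ℝ) ∈ Set.Ioo (φ 1) (φ c) from ⟨hφ1neg, hcpos⟩)
  have simple : ∀ x ∈ Set.Icc (0:ℝ) 1, φ x = 0 → φd x ≠ 0 := fun x hx h h' =>
    hφ1ne (uniq hM2 hφc hφdc hφ1 hφ2 hφode hx h h' 1 h11)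
  exact not_morse hwc hwdc hwa hwb hwode' hw1 hneg hφc hφdc hφ1 hφ2 hφode ha.1
    (ha.2.trans hb.1) hb.2 hφa hφb (simple a ⟨ha.1.le, (ha.2.le.trans hc.2)⟩ hφa)
    (simple b ⟨hc.1.trans hb.1.le, hb.2.le⟩ hφb) hMorse
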